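/- Let A ∈ ℂ^{n₁×n₁×n₃} with ind(A) = k ≥ 1, let A^{GD} be a GD inverse of A, and let A† be the Moore–Penrose inverse of A. Then X = A^{GD} ⋆ A ⋆ A* satisfies the system: X ⋆ (A†)* ⋆ X = X; A^c ⋆ X = A^c ⋆ A* for every integer c ≥ 1; and X ⋆ (A†)* = A^{GD} ⋆ A. -/

import Mathlib

open Matrix BigOperators

/-- A third-order complex tensor in `ℂ^{n₁ × n₂ × n₃}`, given by its frontal slices. -/
abbrev Tensor3 (n₁ n₂ n₃ : ℕ) := Fin n₃ → Matrix (Fin n₁) (Fin n₂) ℂ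

/-- Mode-3 product of a tensor with an `n₃ × n₃` matrix: the slices of the result are the
indicated linear combinations of the slices of `A`. -/
noncomputable def mode3 {n₁ n₂ n₃ : ℕ} (M : Matrix (Fin n₃) (Fin n₃) ℂ) (A : Tensor3 n₁ n₂ n₃) :
    Tensor3 n₁ n₂ n₃ :=
  fun i => ∑ j, M i j • A j

/-- The M-product `A ⋆_M B`: slice-wise matrix product in the transformed (hat) domain,
transformed back by `M⁻¹`. -/
noncomputable def mprod {n₁ n₂ l n₃ : ℕ} (M : Matrix (Fin n₃) (Fin n₃) ℂ)
    (A : Tensor3 n₁ n₂ n₃) (B : Tensor3 n₂ l n₃) : Tensor3 n₁ l n₃ :=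
  mode3 M⁻¹ (fun i => mode3 M A i * mode3 M B i)

/-- The identity tensor: every slice of its mode-3 transform is the identity matrix. -/
noncomputable def idT (n₁ : ℕ) {n₃ : ℕ} (M : Matrix (Fin n₃) (Fin n₃) ℂ) : Tensor3 n₁ n₁ n₃ :=
  mode3 M⁻¹ (fun _ => (1 : Matrix (Fin n₁) (Fin n₁) ℂ))

/-- Powers of a square tensor with respect to the M-product. -/
noncomputable def mpow {n₁ n₃ : ℕ} (M : Matrix (Fin n₃) (Fin n₃) ℂ) (A : Tensor3 n₁ n₁ n₃) :
    ℕ → Tensor3 n₁ n₁ n₃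
  | 0 => idT n₁ M
  | k + 1 => mprod M (mpow M A k) A

/-- Conjugate transpose with respect to the M-product: slice-wise conjugate transpose in the
transformed domain. -/
noncomputable def ctrans {n₁ n₂ n₃ : ℕ} (M : Matrix (Fin n₃) (Fin n₃) ℂ) (A : Tensor3 n₁ n₂ n₃) :
    Tensor3 n₂ n₁ n₃ :=
  mode3 M⁻¹ (fun i => (mode3 M A i)ᴴ)

/-- Index of a square complex matrix: the least `k ≥ 0` with `rank(B^k) = rank(B^{k+1})`. -/
noncomputable def matIndex {n : ℕ} (B : Matrix (Fin n) (Fin n) ℂ) : ℕ :=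
  sInf {k : ℕ | (B ^ k).rank = (B ^ (k + 1)).rank}

/-- Index of a tensor: the maximum of the indices of the slices of its mode-3 transform. -/
noncomputable def tIndex {n₁ n₃ : ℕ} (M : Matrix (Fin n₃) (Fin n₃) ℂ)
    (A : Tensor3 n₁ n₁ n₃) : ℕ :=
  Finset.univ.sup fun i => matIndex (mode3 M A i)

/-- `X` is a GD inverse of `A` with exponent `k`:
`A ⋆ X ⋆ A = A`, `X ⋆ A^{k+1} = A^k`, `A^{k+1} ⋆ X = A^k`. -/
def IsGD {n₁ n₃ : ℕ} (M : Matrix (Fin n₃) (Fin n₃) ℂ) (A X : Tensor3 n₁ n₁ n₃)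
    (k : ℕ) : Prop :=
  mprod M (mprod M A X) A = A ∧
  mprod M X (mpow M A (k + 1)) = mpow M A k ∧
  mprod M (mpow M A (k + 1)) X = mpow M A k

/-- `X` is the Drazin inverse of `A` with exponent `k`. -/
def IsDrazin {n₁ n₃ : ℕ} (M : Matrix (Fin n₃) (Fin n₃) ℂ) (A X : Tensor3 n₁ n₁ n₃)
    (k : ℕ) : Prop :=
  mprod M X (mpow M A (k + 1)) = mpow M A k ∧
  mprod M (mprod M X A) X = X ∧
  mprod M X A = mprod M A X

/-- `X` is the Moore–Penrose inverse of `A`. -/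
def IsMP {n₁ n₃ : ℕ} (M : Matrix (Fin n₃) (Fin n₃) ℂ) (A X : Tensor3 n₁ n₁ n₃) : Prop :=
  mprod M (mprod M A X) A = A ∧
  mprod M (mprod M X A) X = X ∧
  ctrans M (mprod M A X) = mprod M A X ∧
  ctrans M (mprod M X A) = mprod M X A

theorem mode3_mode3 {n₁ n₂ n₃ : ℕ} (M N : Matrix (Fin n₃) (Fin n₃) ℂ) (A : Tensor3 n₁ n₂ n₃) :
    mode3 M (mode3 N A) = mode3 (M * N) A := by
  funext i
  simp only [mode3, Finset.smul_sum, smul_smul, Matrix.mul_apply, Finset.sum_smul]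
  exact Finset.sum_comm

theorem mode3_one {n₁ n₂ n₃ : ℕ} (A : Tensor3 n₁ n₂ n₃) : mode3 1 A = A := by
  funext i
  simp [mode3, Matrix.one_apply]

theorem mode3_mode3_inv {n₁ n₂ n₃ : ℕ} {M : Matrix (Fin n₃) (Fin n₃) ℂ} (hM : IsUnit M)
    (A : Tensor3 n₁ n₂ n₃) : mode3 M (mode3 M⁻¹ A) = A := by
  rw [mode3_mode3, Matrix.mul_nonsing_inv M ((Matrix.isUnit_iff_isUnit_det M).mp hM), mode3_one]

theorem mprod_assoc {n₁ n₂ n₄ n₅ n₃ : ℕ} {M : Matrix (Fin n₃) (Fin n₃) ℂ} (hM : IsUnit M)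
    (A : Tensor3 n₁ n₂ n₃) (B : Tensor3 n₂ n₄ n₃) (C : Tensor3 n₄ n₅ n₃) :
    mprod M (mprod M A B) C = mprod M A (mprod M B C) := by
  simp only [mprod, mode3_mode3_inv hM, Matrix.mul_assoc]

theorem ctrans_mprod {n₁ n₂ n₄ n₃ : ℕ} {M : Matrix (Fin n₃) (Fin n₃) ℂ} (hM : IsUnit M)
    (A : Tensor3 n₁ n₂ n₃) (B : Tensor3 n₂ n₄ n₃) :
    ctrans M (mprod M A B) = mprod M (ctrans M B) (ctrans M A) := by
  simp only [mprod, ctrans, mode3_mode3_inv hM, Matrix.conjTranspose_mul]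

/-- `X = A^{GD} ⋆ A ⋆ A*` satisfies `X ⋆ (A†)* ⋆ X = X`,
`A^c ⋆ X = A^c ⋆ A*` for every `c ≥ 1`, and `X ⋆ (A†)* = A^{GD} ⋆ A`. -/
theorem gdstar_system {n₁ n₃ : ℕ} (hn₁ : 0 < n₁) (hn₃ : 0 < n₃)
    (M : Matrix (Fin n₃) (Fin n₃) ℂ) (hM : IsUnit M)
    (A AGD Adag X : Tensor3 n₁ n₁ n₃) (k : ℕ) (hk : tIndex M A = k) (hk1 : 1 ≤ k)
    (hAGD : IsGD M A AGD k) (hAdag : IsMP M A Adag)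
    (hX : X = mprod M (mprod M AGD A) (ctrans M A)) :
    mprod M (mprod M X (ctrans M Adag)) X = X ∧
    (∀ c : ℕ, 1 ≤ c → mprod M (mpow M A c) X = mprod M (mpow M A c) (ctrans M A)) ∧
    mprod M X (ctrans M Adag) = mprod M AGD A := by
  obtain ⟨hG, -, -⟩ := hAGD
  obtain ⟨hA, -, -, hsymm⟩ := hAdag
  rw [mprod_assoc hM] at hG hA
  have hXdag : mprod M X (ctrans M Adag) = mprod M AGD A := by
    rw [hX, mprod_assoc hM, ← ctrans_mprod hM, hsymm, mprod_assoc hM, hA]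
  refine ⟨?_, ?_, hXdag⟩
  · rw [hXdag, hX, ← mprod_assoc hM, mprod_assoc hM AGD A, hG]
  · rintro (_ | d) hc
    · omega
    · rw [hX, ← mprod_assoc hM]
      simp only [mpow]
      rw [mprod_assoc hM (mpow M A d), hG]
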